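/- There exists a constant c > 0 such that for every s ∈ (0, 1/2], the sum over all quadruples (m₁, m₂, m₃, m₄) of nonzero points of ℤ³ with m₃ + m₄ ≠ 0 of e^{−(|m₁|² + |m₂|² + |m₃|² + |m₄|²) s} / (|m₁|² |m₂| |m₃| |m₃ + m₄| |m₄|²) is at most c s^{−5/2} log(1/s). -/

import Mathlib

open Set

/-- The lattice `ℤ³`. -/
abbrev Z3 := ℤ × ℤ × ℤ

/-- Euclidean norm of a point of `ℤ³`. -/
noncomputable def znorm (m : Z3) : ℝ :=
  Real.sqrt ((m.1 : ℝ) ^ 2 + (m.2.1 : ℝ) ^ 2 + (m.2.2 : ℝ) ^ 2)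

lemma one_dim_nat (θ : ℝ) (h0 : 0 ≤ θ) (h1 : θ < 1) :
    ∃ C > 0, ∀ s : ℝ, 0 < s →
      (∑' k : ℕ, ENNReal.ofReal (Real.exp (-((k : ℝ) + 1) ^ 2 * s) * ((k : ℝ) + 1) ^ (-θ)))
        ≤ ENNReal.ofReal (C * s ^ (-((1 - θ) / 2))) := by
  refine ⟨(1 / 2) * Real.Gamma ((-θ + 1) / 2), ?_, ?_⟩
  · have := Real.Gamma_pos_of_pos (s := (-θ + 1) / 2) (by linarith)
    positivity
  intro s hs
  set f : ℝ → ℝ := fun x => x ^ (-θ) * Real.exp (-s * x ^ (2 : ℝ)) with hf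
  have hint : MeasureTheory.IntegrableOn f (Ioi 0) :=
    integrableOn_rpow_mul_exp_neg_mul_rpow (by linarith) (by norm_num) hs
  have hval : ∫ x in Ioi (0:ℝ), f x = s ^ (-(-θ + 1) / 2) * (1 / 2) * Real.Gamma ((-θ + 1) / 2) :=
    integral_rpow_mul_exp_neg_mul_rpow (by norm_num) (by linarith) hs
  have hval2 : (1 / 2) * Real.Gamma ((-θ + 1) / 2) * s ^ (-((1 - θ) / 2)) =
      ∫ x in Ioi (0:ℝ), f x := by
    rw [hval, show -((1 - θ) / 2) = -(-θ + 1) / 2 by ring]; ring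
  rw [hval2, MeasureTheory.ofReal_integral_eq_lintegral_ofReal hint]
  swap
  · refine (MeasureTheory.ae_restrict_iff' measurableSet_Ioi).2 (Filter.Eventually.of_forall ?_)
    intro x hx
    have : (0:ℝ) < x := hx
    simp only [hf, Pi.zero_apply]; positivity
  have hdis : Pairwise (Function.onFun Disjoint (fun k : ℕ => Ioc (k : ℝ) ((k : ℝ) + 1))) := by
    intro i j hij
    rw [Function.onFun, Set.disjoint_left]
    rintro x ⟨h1, h2⟩ ⟨h3, h4⟩
    apply hij
    have a : i < j + 1 := by exact_mod_cast h1.trans_le h4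
    have b : j < i + 1 := by exact_mod_cast h3.trans_le h2
    omega
  calc _ ≤ ∑' k : ℕ, ∫⁻ x in Ioc (k : ℝ) ((k : ℝ) + 1), ENNReal.ofReal (f x) := by
        refine ENNReal.tsum_le_tsum fun k => ?_
        have : ENNReal.ofReal (Real.exp (-((k : ℝ) + 1) ^ 2 * s) * ((k : ℝ) + 1) ^ (-θ)) =
          ∫⁻ x in Ioc (k : ℝ) ((k : ℝ) + 1),
            ENNReal.ofReal (Real.exp (-((k : ℝ) + 1) ^ 2 * s) * ((k : ℝ) + 1) ^ (-θ)) := by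
          simp
        rw [this]
        refine MeasureTheory.setLIntegral_mono' measurableSet_Ioc fun x hx => ?_
        apply ENNReal.ofReal_le_ofReal
        have hx0 : 0 < x := lt_of_le_of_lt (by positivity) hx.1
        simp only [hf]
        rw [mul_comm, Real.rpow_two]
        have e1 : ((k : ℝ) + 1) ^ (-θ) ≤ x ^ (-θ) :=
          Real.rpow_le_rpow_of_nonpos hx0 hx.2 (by linarith)
        have e2 : x ^ 2 ≤ ((k : ℝ) + 1) ^ 2 := by
          have := hx.2
          gcongr
        have e3 : -((k : ℝ) + 1) ^ 2 * s ≤ -s * x ^ 2 := by nlinarith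
        have e4 := Real.exp_le_exp.2 e3
        gcongr
    _ = ∫⁻ x in ⋃ k : ℕ, Ioc (k : ℝ) ((k : ℝ) + 1), ENNReal.ofReal (f x) := by
        rw [MeasureTheory.lintegral_iUnion (fun _ => measurableSet_Ioc) hdis]
    _ ≤ _ := by
        refine MeasureTheory.lintegral_mono_set ?_
        refine Set.iUnion_subset fun k x hx => ?_
        exact lt_of_le_of_lt (by positivity) hx.1

noncomputable def gg (θ s : ℝ) (a : ℤ) : ℝ :=
  Real.exp (-(a : ℝ) ^ 2 * s) * (max 1 |(a : ℝ)|) ^ (-θ)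

lemma gg_nonneg (θ s : ℝ) (a : ℤ) : 0 ≤ gg θ s a := by
  unfold gg; positivity

lemma one_dim (θ : ℝ) (h0 : 0 ≤ θ) (h1 : θ < 1) :
    ∃ C > 0, ∀ s : ℝ, 0 < s → s ≤ 1 →
      (∑' a : ℤ, ENNReal.ofReal (gg θ s a)) ≤ ENNReal.ofReal (C * s ^ (-((1 - θ) / 2))) := by
  obtain ⟨C, hC, H⟩ := one_dim_nat θ h0 h1
  refine ⟨1 + C + C, by positivity, fun s hs hs1 => ?_⟩
  have hk : ∀ k : ℕ, gg θ s ((k + 1 : ℕ) : ℤ) =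
      Real.exp (-((k : ℝ) + 1) ^ 2 * s) * ((k : ℝ) + 1) ^ (-θ) := by
    intro k
    have : (0:ℝ) ≤ k := by positivity
    simp only [gg]
    push_cast
    rw [abs_of_nonneg (by positivity), max_eq_right (by linarith)]
  have hk' : ∀ k : ℕ, gg θ s (Int.negSucc k) =
      Real.exp (-((k : ℝ) + 1) ^ 2 * s) * ((k : ℝ) + 1) ^ (-θ) := by
    intro k
    rw [← hk]
    simp only [gg, Int.negSucc_eq]
    push_cast
    rw [abs_neg, neg_sq]
  have hp : (1:ℝ) ≤ s ^ (-((1 - θ) / 2)) :=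
    Real.one_le_rpow_of_pos_of_le_one_of_nonpos hs hs1 (by linarith)
  have hsum : (∑' a : ℤ, ENNReal.ofReal (gg θ s a)) =
      (∑' k : ℕ, ENNReal.ofReal (gg θ s (k : ℤ))) +
        ∑' k : ℕ, ENNReal.ofReal (gg θ s (Int.negSucc k)) := by
    rw [← Equiv.tsum_eq Equiv.intEquivNatSumNat.symm,
      ENNReal.summable.tsum_sum ENNReal.summable]
    rfl
  rw [hsum, tsum_eq_zero_add' ENNReal.summable]
  simp only [hk, hk']
  have hz : gg θ s ((0 : ℕ) : ℤ) = 1 := by simp [gg]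
  rw [hz]
  calc _ ≤ ENNReal.ofReal (s ^ (-((1 - θ) / 2))) + ENNReal.ofReal (C * s ^ (-((1 - θ) / 2)))
          + ENNReal.ofReal (C * s ^ (-((1 - θ) / 2))) := by
        gcongr
        · exact H s hs
        · exact H s hs
    _ = _ := by
        rw [← ENNReal.ofReal_add (by positivity) (by positivity),
          ← ENNReal.ofReal_add (by positivity) (by positivity)]
        congr 1; ring

noncomputable def FF (p : ℕ) (s : ℝ) (m : Z3) : ℝ :=
  if m = 0 then 0 else Real.exp (-(znorm m ^ 2 * s)) / znorm m ^ p

lemma FF_nonneg (p : ℕ) (s : ℝ) (m : Z3) : 0 ≤ FF p s m := by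
  unfold FF znorm
  split_ifs
  · exact le_rfl
  · positivity

lemma znorm_sq (m : Z3) :
    znorm m ^ 2 = (m.1 : ℝ) ^ 2 + (m.2.1 : ℝ) ^ 2 + (m.2.2 : ℝ) ^ 2 :=
  Real.sq_sqrt (by positivity)

lemma one_le_znorm {m : Z3} (hm : m ≠ 0) : 1 ≤ znorm m := by
  rw [znorm, Real.one_le_sqrt]
  have : 1 ≤ m.1 ^ 2 + m.2.1 ^ 2 + m.2.2 ^ 2 := by
    by_contra hcon
    apply hm
    have a := sq_nonneg m.1
    have b := sq_nonneg m.2.1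
    have c := sq_nonneg m.2.2
    have a' : m.1 ^ 2 = 0 := by omega
    have b' : m.2.1 ^ 2 = 0 := by omega
    have c' : m.2.2 ^ 2 = 0 := by omega
    ext
    · simpa using a'
    · simpa using b'
    · simpa using c'
  exact_mod_cast this

lemma FF_le (p : ℕ) (s : ℝ) (m : Z3) :
    FF p s m ≤ gg (p / 3) s m.1 * (gg (p / 3) s m.2.1 * gg (p / 3) s m.2.2) := by
  by_cases hm : m = 0
  · simp only [FF, hm, if_true]
    have := gg_nonneg (p / 3) s
    exact mul_nonneg (this _) (mul_nonneg (this _) (this _))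
  have h1 := one_le_znorm hm
  have hz := znorm_sq m
  have key : ∀ a : ℤ, (a : ℝ) ^ 2 ≤ znorm m ^ 2 →
      znorm m ^ (-((p : ℝ) / 3)) ≤ (max 1 |(a : ℝ)|) ^ (-((p : ℝ) / 3)) := by
    intro a ha
    have : |(a : ℝ)| ≤ znorm m := abs_le_of_sq_le_sq ha (by linarith)
    exact Real.rpow_le_rpow_of_nonpos (by positivity) (max_le h1 this)
      (by have : (0:ℝ) ≤ p := by positivity
          linarith)
  have k1 := key m.1 (by nlinarith [sq_nonneg (m.2.1 : ℝ), sq_nonneg (m.2.2 : ℝ)])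
  have k2 := key m.2.1 (by nlinarith [sq_nonneg (m.1 : ℝ), sq_nonneg (m.2.2 : ℝ)])
  have k3 := key m.2.2 (by nlinarith [sq_nonneg (m.1 : ℝ), sq_nonneg (m.2.1 : ℝ)])
  have hzp : 0 < znorm m := by linarith
  have e : (znorm m ^ p)⁻¹ = znorm m ^ (-((p : ℝ) / 3)) *
      (znorm m ^ (-((p : ℝ) / 3)) * znorm m ^ (-((p : ℝ) / 3))) := by
    rw [← Real.rpow_add hzp, ← Real.rpow_add hzp, ← Real.rpow_natCast,
      ← Real.rpow_neg hzp.le]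
    congr 1; ring
  have ee : Real.exp (-(znorm m ^ 2 * s)) = Real.exp (-(m.1 : ℝ) ^ 2 * s) *
      (Real.exp (-(m.2.1 : ℝ) ^ 2 * s) * Real.exp (-(m.2.2 : ℝ) ^ 2 * s)) := by
    rw [← Real.exp_add, ← Real.exp_add, hz]
    congr 1; ring
  rw [FF, if_neg hm, div_eq_mul_inv, e]
  calc _ ≤ Real.exp (-(znorm m ^ 2 * s)) * ((max 1 |(m.1 : ℝ)|) ^ (-((p : ℝ) / 3)) *
      ((max 1 |(m.2.1 : ℝ)|) ^ (-((p : ℝ) / 3)) * (max 1 |(m.2.2 : ℝ)|) ^ (-((p : ℝ) / 3)))) := by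
        gcongr
    _ = _ := by
        rw [ee]; unfold gg; ring

lemma three_dim (p : ℕ) (hp : p < 3) :
    ∃ C > 0, ∀ s : ℝ, 0 < s → s ≤ 1 →
      (∑' m : Z3, ENNReal.ofReal (FF p s m)) ≤
        ENNReal.ofReal (C * s ^ (-((3 - (p : ℝ)) / 2))) := by
  have hp' : (p : ℝ) < 3 := by exact_mod_cast hp
  obtain ⟨C, hC, H⟩ := one_dim ((p : ℝ) / 3) (by positivity) (by linarith)
  refine ⟨C ^ 3, by positivity, fun s hs hs1 => ?_⟩
  have h := H s hs hs1
  calc _ ≤ ∑' m : Z3, ENNReal.ofReal (gg (p / 3) s m.1) *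
        (ENNReal.ofReal (gg (p / 3) s m.2.1) * ENNReal.ofReal (gg (p / 3) s m.2.2)) := by
        refine ENNReal.tsum_le_tsum fun m => ?_
        rw [← ENNReal.ofReal_mul (gg_nonneg _ _ _), ← ENNReal.ofReal_mul (gg_nonneg _ _ _)]
        exact ENNReal.ofReal_le_ofReal (FF_le p s m)
    _ = (∑' a : ℤ, ENNReal.ofReal (gg (p / 3) s a)) *
          ((∑' a : ℤ, ENNReal.ofReal (gg (p / 3) s a)) *
            (∑' a : ℤ, ENNReal.ofReal (gg (p / 3) s a))) := by
        rw [ENNReal.tsum_prod']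
        simp only [ENNReal.tsum_mul_left, ENNReal.tsum_mul_right]
        rw [ENNReal.tsum_prod']
        simp only [ENNReal.tsum_mul_left, ENNReal.tsum_mul_right]
    _ ≤ _ := mul_le_mul' h (mul_le_mul' h h)
    _ = _ := by
        rw [← ENNReal.ofReal_mul (by positivity), ← ENNReal.ofReal_mul (by positivity)]
        congr 1
        have : s ^ (-((3 - (p : ℝ)) / 2)) = s ^ (-((1 - (p : ℝ) / 3) / 2)) *
            (s ^ (-((1 - (p : ℝ) / 3) / 2)) * s ^ (-((1 - (p : ℝ) / 3) / 2))) := by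
          rw [← Real.rpow_add hs, ← Real.rpow_add hs]
          congr 1; ring
        rw [this]; ring

lemma pair_le (s : ℝ) (m n : Z3) (hs : 0 < s) (hm : m ≠ 0) (hn : n ≠ 0) :
    Real.exp (-(znorm m ^ 2 * s)) / (znorm m * znorm n) ≤ FF 2 s m + FF 2 s n := by
  have h1 := one_le_znorm hm
  have h2 := one_le_znorm hn
  have p1 := FF_nonneg 2 s m
  have p2 := FF_nonneg 2 s n
  rcases le_total (znorm m) (znorm n) with h | h
  · refine le_trans ?_ (le_add_of_nonneg_right p2)
    rw [FF, if_neg hm, sq (znorm m)]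
    gcongr
  · refine le_trans ?_ (le_add_of_nonneg_left p1)
    rw [FF, if_neg hn]
    have : znorm n ^ 2 ≤ znorm m * znorm n := by nlinarith
    gcongr

lemma term_le (s : ℝ) (hs : 0 < s) (a b m n : Z3) (ha : a ≠ 0) (hb : b ≠ 0) (hm : m ≠ 0)
    (hn : n ≠ 0) (hmn : m + n ≠ 0) :
    Real.exp (-((znorm a ^ 2 + znorm b ^ 2 + znorm m ^ 2 + znorm n ^ 2) * s)) /
      (znorm a ^ 2 * znorm b * znorm m * znorm (m + n) * znorm n ^ 2) ≤
    FF 2 s a * (FF 1 s b * (FF 2 s n * (FF 2 s m + FF 2 s (m + n)))) := by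
  have h := pair_le s m (m + n) hs hm hmn
  have e : Real.exp (-((znorm a ^ 2 + znorm b ^ 2 + znorm m ^ 2 + znorm n ^ 2) * s)) /
      (znorm a ^ 2 * znorm b * znorm m * znorm (m + n) * znorm n ^ 2) =
      FF 2 s a * (FF 1 s b * (FF 2 s n *
        (Real.exp (-(znorm m ^ 2 * s)) / (znorm m * znorm (m + n))))) := by
    have : Real.exp (-((znorm a ^ 2 + znorm b ^ 2 + znorm m ^ 2 + znorm n ^ 2) * s)) =
      Real.exp (-(znorm a ^ 2 * s)) * Real.exp (-(znorm b ^ 2 * s)) *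
        Real.exp (-(znorm m ^ 2 * s)) * Real.exp (-(znorm n ^ 2 * s)) := by
      rw [← Real.exp_add, ← Real.exp_add, ← Real.exp_add]
      congr 1; ring
    rw [this]
    simp only [FF, if_neg ha, if_neg hb, if_neg hn, pow_one, div_eq_mul_inv, mul_inv]
    ring
  rw [e]
  have := FF_nonneg 2 s a
  have := FF_nonneg 1 s b
  have := FF_nonneg 2 s n
  gcongr

lemma tsum_prod_mul {X Y : Type} (f : X → ENNReal) (g : Y → ENNReal) :
    ∑' q : X × Y, f q.1 * g q.2 = (∑' x, f x) * ∑' y, g y := by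
  rw [ENNReal.tsum_prod']
  simp only [ENNReal.tsum_mul_left, ENNReal.tsum_mul_right]

lemma tsum_shift (α : Z3 → ENNReal) :
    ∑' q : Z3 × Z3, α q.2 * (α q.1 + α (q.1 + q.2)) =
      (∑' m, α m) * ((∑' m, α m) + (∑' m, α m)) := by
  have h : ∀ n : Z3, ∑' m : Z3, α (m + n) = ∑' m, α m := fun n =>
    (Equiv.addRight n).tsum_eq α
  rw [ENNReal.tsum_prod', ENNReal.tsum_comm]
  simp only [ENNReal.tsum_mul_left, ENNReal.tsum_mul_right, ENNReal.tsum_add, h]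

theorem stmt16 :
    ∃ c > 0, ∀ s ∈ Set.Ioc (0:ℝ) (1/2),
      (∑' q : {q : Z3 × Z3 × Z3 × Z3 //
          q.1 ≠ 0 ∧ q.2.1 ≠ 0 ∧ q.2.2.1 ≠ 0 ∧ q.2.2.2 ≠ 0 ∧ q.2.2.1 + q.2.2.2 ≠ 0},
          ENNReal.ofReal
            (Real.exp (-((znorm (q : Z3 × Z3 × Z3 × Z3).1 ^ 2
                + znorm (q : Z3 × Z3 × Z3 × Z3).2.1 ^ 2
                + znorm (q : Z3 × Z3 × Z3 × Z3).2.2.1 ^ 2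
                + znorm (q : Z3 × Z3 × Z3 × Z3).2.2.2 ^ 2) * s)) /
              (znorm (q : Z3 × Z3 × Z3 × Z3).1 ^ 2
                * znorm (q : Z3 × Z3 × Z3 × Z3).2.1
                * znorm (q : Z3 × Z3 × Z3 × Z3).2.2.1
                * znorm ((q : Z3 × Z3 × Z3 × Z3).2.2.1 + (q : Z3 × Z3 × Z3 × Z3).2.2.2)
                * znorm (q : Z3 × Z3 × Z3 × Z3).2.2.2 ^ 2))) ≤
        ENNReal.ofReal (c * s ^ (-(5/2 : ℝ)) * Real.log (1 / s)) := by
  obtain ⟨C, hC, HA⟩ := three_dim 2 (by norm_num)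
  obtain ⟨D, hD, HB⟩ := three_dim 1 (by norm_num)
  have hlog2 : 0 < Real.log 2 := Real.log_pos (by norm_num)
  refine ⟨C * (D * (C * (C + C))) / Real.log 2, by positivity, ?_⟩
  rintro s ⟨hs, hs2⟩
  have hA := HA s hs (by linarith)
  have hB := HB s hs (by linarith)
  set α : Z3 → ENNReal := fun m => ENNReal.ofReal (FF 2 s m) with hα
  set β : Z3 → ENNReal := fun m => ENNReal.ofReal (FF 1 s m) with hβ
  calc _ ≤ ∑' q : {q : Z3 × Z3 × Z3 × Z3 //
          q.1 ≠ 0 ∧ q.2.1 ≠ 0 ∧ q.2.2.1 ≠ 0 ∧ q.2.2.2 ≠ 0 ∧ q.2.2.1 + q.2.2.2 ≠ 0},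
          (fun q : Z3 × Z3 × Z3 × Z3 => α q.1 * (β q.2.1 * (α q.2.2.2 *
            (α q.2.2.1 + α (q.2.2.1 + q.2.2.2))))) q := by
        refine ENNReal.tsum_le_tsum ?_
        rintro ⟨⟨a, b, m, n⟩, ha, hb, hm, hn, hmn⟩
        simp only [hα, hβ]
        rw [← ENNReal.ofReal_add (FF_nonneg _ _ _) (FF_nonneg _ _ _),
          ← ENNReal.ofReal_mul (FF_nonneg _ _ _), ← ENNReal.ofReal_mul (FF_nonneg _ _ _),
          ← ENNReal.ofReal_mul (FF_nonneg _ _ _)]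
        exact ENNReal.ofReal_le_ofReal (term_le s hs a b m n ha hb hm hn hmn)
    _ ≤ ∑' q : Z3 × Z3 × Z3 × Z3, α q.1 * (β q.2.1 * (α q.2.2.2 *
            (α q.2.2.1 + α (q.2.2.1 + q.2.2.2)))) :=
        ENNReal.tsum_comp_le_tsum_of_injective Subtype.val_injective _
    _ = (∑' m, α m) * ((∑' m, β m) * ((∑' m, α m) * ((∑' m, α m) + (∑' m, α m)))) := by
        rw [← tsum_shift, ← tsum_prod_mul β, ← tsum_prod_mul α]
    _ ≤ _ := mul_le_mul' hA (mul_le_mul' hB (mul_le_mul' hA (add_le_add hA hA)))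
    _ ≤ _ := by
        rw [← ENNReal.ofReal_add (by positivity) (by positivity),
          ← ENNReal.ofReal_mul (by positivity), ← ENNReal.ofReal_mul (by positivity),
          ← ENNReal.ofReal_mul (by positivity)]
        apply ENNReal.ofReal_le_ofReal
        have e : s ^ (-(5/2 : ℝ)) = s ^ (-((3 - ((2 : ℕ) : ℝ)) / 2)) *
            (s ^ (-((3 - ((1 : ℕ) : ℝ)) / 2)) * (s ^ (-((3 - ((2 : ℕ) : ℝ)) / 2)) *
              s ^ (-((3 - ((2 : ℕ) : ℝ)) / 2)))) := by
          rw [← Real.rpow_add hs, ← Real.rpow_add hs, ← Real.rpow_add hs]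
          congr 1; norm_num
        have hl : Real.log 2 ≤ Real.log (1 / s) := by
          apply Real.log_le_log (by norm_num)
          rw [le_div_iff₀ hs]; linarith
        calc _ = C * (D * (C * (C + C))) / Real.log 2 * s ^ (-(5/2 : ℝ)) * Real.log 2 := by
              rw [e]; field_simp
          _ ≤ _ := by gcongr
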